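/- Let q ∈ (0, 1/2) and let c ∈ ℕ be such that 2/c < q. Then there is k ∈ ℕ such that, with ĥ(n) = ⌊2^(n/k)⌋, we have 𝔡(q − 2/c) ≤ 𝔡⟨≠*, ĥ, q⟩ and 𝔟(q − 2/c) ≥ 𝔟⟨≠*, ĥ, q⟩. -/

import Mathlib

open Filter

namespace Paper

/-! ### Oracle computability -/

/-- Codes for oracle Turing functionals (partial recursive operators with one
function oracle), following the pattern of `Nat.Partrec.Code`. -/
inductive OracleCode : Type
  | zero
  | succ
  | left
  | right
  | oracle
  | pair : OracleCode → OracleCode → OracleCode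
  | comp : OracleCode → OracleCode → OracleCode
  | prec : OracleCode → OracleCode → OracleCode
  | rfind' : OracleCode → OracleCode

/-- Evaluation of an oracle code with oracle `g : ℕ → ℕ`. -/
def OracleCode.eval (g : ℕ → ℕ) : OracleCode → ℕ →. ℕ
  | .zero => pure 0
  | .succ => Nat.succ
  | .left => ↑fun n : ℕ => n.unpair.1
  | .right => ↑fun n : ℕ => n.unpair.2
  | .oracle => ↑fun n : ℕ => g n
  | .pair cf cg => fun n => Nat.pair <$> eval g cf n <*> eval g cg n
  | .comp cf cg => fun n => eval g cg n >>= eval g cf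
  | .prec cf cg =>
    Nat.unpaired fun a n =>
      n.rec (eval g cf a) fun y IH => do
        let i ← IH
        eval g cg (Nat.pair a (Nat.pair y i))
  | .rfind' cf =>
    Nat.unpaired fun a m =>
      (Nat.rfind fun n => (fun m => m = 0) <$> eval g cf (Nat.pair a (n + m))).map (· + m)

/-- Turing reducibility: `f ≤_T g` iff some oracle functional with oracle `g`
computes `f` (totally). -/
def TuringLE (f g : ℕ → ℕ) : Prop :=
  ∃ c : OracleCode, ∀ n, OracleCode.eval g c n = Part.some (f n)

/-- Turing equivalence. -/
def TuringEquiv (f g : ℕ → ℕ) : Prop := TuringLE f g ∧ TuringLE g f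

/-- A mass problem is a set of functions `ℕ → ℕ`. -/
abbrev MassProblem := Set (ℕ → ℕ)

/-- Muchnik (weak) reducibility `B ≤_W C`. -/
def MuchnikLE (B C : MassProblem) : Prop := ∀ g ∈ C, ∃ f ∈ B, TuringLE f g

/-- Muchnik equivalence. -/
def MuchnikEquiv (B C : MassProblem) : Prop := MuchnikLE B C ∧ MuchnikLE C B

/-- Medvedev (strong) reducibility `B ≤_S C`: a single Turing functional is
defined on all of `C` and maps each member of `C` to a member of `B`. -/
def MedvedevLE (B C : MassProblem) : Prop :=
  ∃ c : OracleCode, ∀ g ∈ C, ∃ f ∈ B, ∀ n, OracleCode.eval g c n = Part.some (f n)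

/-- Medvedev equivalence. -/
def MedvedevEquiv (B C : MassProblem) : Prop := MedvedevLE B C ∧ MedvedevLE C B

/-! ### Density notions -/

/-- Lower (asymptotic) density of a set of naturals. -/
noncomputable def lowerDensity (z : Set ℕ) : ℝ :=
  Filter.liminf (fun n => (Nat.card ↥(z ∩ Set.Iio n) : ℝ) / n) Filter.atTop

/-- `x ↔ y`: the agreement set of two functions. -/
def agree (x y : ℕ → ℕ) : Set ℕ := {n | x n = y n}

/-- A bit sequence is a `{0,1}`-valued function. -/
def IsBitSeq (x : ℕ → ℕ) : Prop := ∀ n, x n < 2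

/-- The mass problem `D(p)`. -/
def probD (p : ℝ) : MassProblem :=
  {y | IsBitSeq y ∧ ∀ x : ℕ → ℕ, IsBitSeq x → Computable x →
    lowerDensity (agree x y) ≤ p}

/-- The mass problem `B(p)`. -/
def probB (p : ℝ) : MassProblem :=
  {y | IsBitSeq y ∧ ∀ x : ℕ → ℕ, IsBitSeq x → Computable x →
    p < lowerDensity (agree x y)}

/-- The mass problem `IOE(h)`. -/
def IOE (h : ℕ → ℕ) : MassProblem :=
  {f | ∀ x : ℕ → ℕ, Computable x → (∀ n, x n < h n) → ∃ᶠ n in atTop, f n = x n}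

/-- The mass problem `AED(h)`. -/
def AED (h : ℕ → ℕ) : MassProblem :=
  {f | (∀ n, f n < h n) ∧ ∀ x : ℕ → ℕ, Computable x → ∀ᶠ n in atTop, f n ≠ x n}

/-! ### Hamming distance and the problems `D⟨≠*,ĥ,q⟩`, `B⟨≠*,ĥ,q⟩` -/

/-- Normalized Hamming distance between `a` and `b`, viewed as binary strings
of length `r` (via binary expansion with leading zeros). -/
noncomputable def nhd (r a b : ℕ) : ℝ :=
  (((Finset.range r).filter fun i => a.testBit i ≠ b.testBit i).card : ℝ) / r

/-- The mass problem `D⟨≠*, ĥ, q⟩`. -/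
def probDneq (hh : ℕ → ℕ) (q : ℝ) : MassProblem :=
  {y | (∀ n, y n < 2 ^ hh n) ∧ ∀ x : ℕ → ℕ, Computable x → (∀ n, x n < 2 ^ hh n) →
    ∃ᶠ n in atTop, nhd (hh n) (x n) (y n) < q}

/-- The mass problem `B⟨≠*, ĥ, q⟩`. -/
def probBneq (hh : ℕ → ℕ) (q : ℝ) : MassProblem :=
  {y | (∀ n, y n < 2 ^ hh n) ∧ ∀ x : ℕ → ℕ, Computable x → (∀ n, x n < 2 ^ hh n) →
    ∀ᶠ n in atTop, q ≤ nhd (hh n) (x n) (y n)}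

/-! ### Slaloms, coded as functions `ℕ → ℕ` via binary digits -/

/-- `s : ℕ → ℕ`, coding finite sets via binary digits (`i ∈ s(n)` iff the
`i`-th bit of `s n` is set), is an `L`-slalom bounded by `u`. -/
def IsSlalomCode (u : ℕ → ℕ) (L : ℕ) (s : ℕ → ℕ) : Prop :=
  ∀ n, (∀ i, (s n).testBit i = true → i < u n) ∧
    ((Finset.range (u n)).filter fun i => (s n).testBit i = true).card ≤ L

/-- The mass problem `D⟨∌*, u, L⟩`. -/
def probDSlalom (u : ℕ → ℕ) (L : ℕ) : MassProblem :=
  {s | IsSlalomCode u L s ∧ ∀ y : ℕ → ℕ, Computable y → (∀ n, y n < u n) →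
    ∃ᶠ n in atTop, (s n).testBit (y n) = true}

/-- The mass problem `B⟨∌*, u, L⟩`. -/
def probBSlalom (u : ℕ → ℕ) (L : ℕ) : MassProblem :=
  {y | (∀ n, y n < u n) ∧ ∀ s : ℕ → ℕ, Computable s → IsSlalomCode u L s →
    ∀ᶠ n in atTop, (s n).testBit (y n) = false}

/-! ### Gamma and Delta values -/

/-- `γ(A)`. -/
noncomputable def gammaVal (A : ℕ → ℕ) : ℝ :=
  sSup ((fun x => lowerDensity (agree A x)) '' {x | IsBitSeq x ∧ Computable x})

/-- `Γ(A)`. -/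
noncomputable def GammaVal (A : ℕ → ℕ) : ℝ :=
  sInf (gammaVal '' {Y | IsBitSeq Y ∧ TuringEquiv Y A})

/-- `δ(A)`. -/
noncomputable def deltaVal (A : ℕ → ℕ) : ℝ :=
  sInf ((fun x => lowerDensity (agree A x)) '' {x | IsBitSeq x ∧ Computable x})

/-- `Δ(A)`. -/
noncomputable def DeltaVal (A : ℕ → ℕ) : ℝ :=
  sSup (deltaVal '' {Y | IsBitSeq Y ∧ TuringLE Y A})

/-! ### Cardinal characteristics -/

/-- The cardinal characteristic `𝔡(p)`. -/
noncomputable def dChar (p : ℝ) : Cardinal :=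
  sInf {c : Cardinal | ∃ G : Set (ℕ → ℕ), c = Cardinal.mk G ∧ (∀ y ∈ G, IsBitSeq y) ∧
    ∀ x : ℕ → ℕ, IsBitSeq x → ∃ y ∈ G, p < lowerDensity (agree x y)}

/-- The cardinal characteristic `𝔟(p)`. -/
noncomputable def bChar (p : ℝ) : Cardinal :=
  sInf {c : Cardinal | ∃ F : Set (ℕ → ℕ), c = Cardinal.mk F ∧ (∀ x ∈ F, IsBitSeq x) ∧
    ∀ y : ℕ → ℕ, IsBitSeq y → ∃ x ∈ F, lowerDensity (agree x y) ≤ p}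

/-- The cardinal characteristic `𝔡(≠*, h)`. -/
noncomputable def dNeq (h : ℕ → ℕ) : Cardinal :=
  sInf {c : Cardinal | ∃ G : Set (ℕ → ℕ), c = Cardinal.mk G ∧ (∀ y ∈ G, ∀ n, y n < h n) ∧
    ∀ x : ℕ → ℕ, ∃ y ∈ G, ∀ᶠ n in atTop, x n ≠ y n}

/-- The cardinal characteristic `𝔟(≠*, h)`. -/
noncomputable def bNeq (h : ℕ → ℕ) : Cardinal :=
  sInf {c : Cardinal | ∃ F : Set (ℕ → ℕ), c = Cardinal.mk F ∧
    ∀ y : ℕ → ℕ, (∀ n, y n < h n) → ∃ x ∈ F, ∃ᶠ n in atTop, x n = y n}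

/-- The cardinal characteristic `𝔡⟨≠*, ĥ, q⟩`. -/
noncomputable def dHam (hh : ℕ → ℕ) (q : ℝ) : Cardinal :=
  sInf {c : Cardinal | ∃ G : Set (ℕ → ℕ), c = Cardinal.mk G ∧
    (∀ y ∈ G, ∀ n, y n < 2 ^ hh n) ∧
    ∀ x : ℕ → ℕ, (∀ n, x n < 2 ^ hh n) →
      ∃ y ∈ G, ∀ᶠ n in atTop, q ≤ nhd (hh n) (x n) (y n)}

/-- The cardinal characteristic `𝔟⟨≠*, ĥ, q⟩`. -/
noncomputable def bHam (hh : ℕ → ℕ) (q : ℝ) : Cardinal :=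
  sInf {c : Cardinal | ∃ F : Set (ℕ → ℕ), c = Cardinal.mk F ∧
    (∀ x ∈ F, ∀ n, x n < 2 ^ hh n) ∧
    ∀ y : ℕ → ℕ, (∀ n, y n < 2 ^ hh n) →
      ∃ x ∈ F, ∃ᶠ n in atTop, nhd (hh n) (x n) (y n) < q}

/-- `s : ℕ → Finset ℕ` is an `L`-slalom bounded by `u`. -/
def IsSlalom (u : ℕ → ℕ) (L : ℕ) (s : ℕ → Finset ℕ) : Prop :=
  ∀ n, (∀ i ∈ s n, i < u n) ∧ (s n).card ≤ L

/-- The cardinal characteristic `𝔡⟨∌*, u, L⟩`. -/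
noncomputable def dSlalom (u : ℕ → ℕ) (L : ℕ) : Cardinal :=
  sInf {c : Cardinal | ∃ G : Set (ℕ → ℕ), c = Cardinal.mk G ∧ (∀ y ∈ G, ∀ n, y n < u n) ∧
    ∀ s : ℕ → Finset ℕ, IsSlalom u L s → ∃ y ∈ G, ∀ᶠ n in atTop, y n ∉ s n}

/-- The cardinal characteristic `𝔟⟨∌*, u, L⟩`. -/
noncomputable def bSlalom (u : ℕ → ℕ) (L : ℕ) : Cardinal :=
  sInf {c : Cardinal | ∃ F : Set (ℕ → Finset ℕ), c = Cardinal.mk F ∧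
    (∀ s ∈ F, IsSlalom u L s) ∧
    ∀ y : ℕ → ℕ, (∀ n, y n < u n) → ∃ s ∈ F, ∃ᶠ n in atTop, y n ∈ s n}

/-! ### Order functions and list decoding -/

/-- An order function: nondecreasing, unbounded and computable. -/
def IsOrderFunc (F : ℕ → ℕ) : Prop :=
  Computable F ∧ Monotone F ∧ ∀ b : ℕ, ∃ n, b < F n

/-- The list-decoding property for parameters `q`, `ε`, `L`: for every length `r`
there is a set `C` of `2^⌊εr⌋` binary strings of length `r` (coded as numbers
below `2^r`) such that every string has at most `L` elements of `C` within
normalized Hamming distance `< q`. -/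
def ListDecoding (q ε : ℝ) (L : ℕ) : Prop :=
  ∀ r : ℕ, ∃ C : Finset ℕ, (∀ a ∈ C, a < 2 ^ r) ∧ C.card = 2 ^ ⌊ε * r⌋₊ ∧
    ∀ σ < 2 ^ r, (C.filter fun τ => nhd r σ τ < q).card ≤ L


/-! ### Concatenating blocks -/

/-- Start of the `n`-th block. -/
def blk (hh : ℕ → ℕ) (n : ℕ) : ℕ := ∑ i ∈ Finset.range n, hh i

/-- Index of the block containing the position `m`. -/
def idx (hh : ℕ → ℕ) (m : ℕ) : ℕ := Nat.findGreatest (fun n => blk hh n ≤ m) m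

/-- Cut a bit sequence into blocks. -/
def enc (hh : ℕ → ℕ) (x : ℕ → ℕ) (n : ℕ) : ℕ :=
  Nat.ofBits (fun i : Fin (hh n) => decide (x (blk hh n + i) = 1))

/-- Concatenate the complements of the blocks. -/
def dec (hh : ℕ → ℕ) (y : ℕ → ℕ) (m : ℕ) : ℕ :=
  if (y (idx hh m)).testBit (m - blk hh (idx hh m)) then 0 else 1

lemma blk_succ (hh : ℕ → ℕ) (n : ℕ) : blk hh (n + 1) = blk hh n + hh n := by
  simp [blk, Finset.sum_range_succ]

lemma blk_mono (hh : ℕ → ℕ) : Monotone (blk hh) :=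
  monotone_nat_of_le_succ fun n => by rw [blk_succ]; omega

lemma le_blk {hh : ℕ → ℕ} (hpos : ∀ n, 1 ≤ hh n) (n : ℕ) : n ≤ blk hh n := by
  induction n with
  | zero => simp
  | succ n ih => rw [blk_succ]; have := hpos n; omega

lemma blk_idx_le (hh : ℕ → ℕ) (m : ℕ) : blk hh (idx hh m) ≤ m :=
  Nat.findGreatest_spec (P := fun n => blk hh n ≤ m) (Nat.zero_le m) (by simp [blk])

lemma lt_blk_idx {hh : ℕ → ℕ} (hpos : ∀ n, 1 ≤ hh n) (m : ℕ) :
    m < blk hh (idx hh m + 1) := by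
  by_contra! h
  have h1 : idx hh m + 1 ≤ m := (le_blk hpos _).trans h
  have h2 : idx hh m + 1 ≤ idx hh m := Nat.le_findGreatest (P := fun n => blk hh n ≤ m) h1 h
  omega

lemma idx_eq {hh : ℕ → ℕ} (hpos : ∀ n, 1 ≤ hh n) (n i : ℕ) (hi : i < hh n) :
    idx hh (blk hh n + i) = n := by
  have h1 := blk_idx_le hh (blk hh n + i)
  have h2 := lt_blk_idx hpos (blk hh n + i)
  apply le_antisymm
  · by_contra! h
    have := blk_mono hh (Nat.succ_le_of_lt h)
    simp only [Nat.succ_eq_add_one, blk_succ] at this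
    omega
  · by_contra! h
    have := blk_mono hh (Nat.succ_le_of_lt h)
    simp only [Nat.succ_eq_add_one] at this
    omega

lemma enc_lt (hh : ℕ → ℕ) (x : ℕ → ℕ) (n : ℕ) : enc hh x n < 2 ^ hh n :=
  Nat.ofBits_lt_two_pow _

lemma dec_bit (hh : ℕ → ℕ) (y : ℕ → ℕ) : IsBitSeq (dec hh y) := by
  intro m; unfold dec; split <;> omega

lemma agree_iff {hh : ℕ → ℕ} (hpos : ∀ n, 1 ≤ hh n) {x : ℕ → ℕ} (hx : IsBitSeq x)
    (y : ℕ → ℕ) (n i : ℕ) (hi : i < hh n) :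
    x (blk hh n + i) = dec hh y (blk hh n + i) ↔
      (enc hh x n).testBit i ≠ (y n).testBit i := by
  have h2 := hx (blk hh n + i)
  unfold dec enc
  rw [idx_eq hpos n i hi, Nat.testBit_ofBits_lt _ _ hi, Nat.add_sub_cancel_left]
  rcases h : (y n).testBit i <;> simp <;> omega

open Classical in
lemma block_count {hh : ℕ → ℕ} (hpos : ∀ n, 1 ≤ hh n) {x : ℕ → ℕ} (hx : IsBitSeq x)
    (y : ℕ → ℕ) (n : ℕ) :
    (Nat.count (fun m => x m = dec hh y m) (blk hh (n + 1)) : ℝ) =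
      Nat.count (fun m => x m = dec hh y m) (blk hh n) +
        nhd (hh n) (enc hh x n) (y n) * hh n := by
  have hp : (hh n : ℝ) ≠ 0 := by have := hpos n; positivity
  rw [blk_succ, Nat.count_add, nhd, div_mul_cancel₀ _ hp]
  push_cast
  congr 2
  rw [Nat.count_eq_card_filter_range]
  congr 1
  apply Finset.filter_congr
  intro i hi
  exact agree_iff hpos hx y n i (Finset.mem_range.1 hi)

open Classical in
lemma card_agree (x y : ℕ → ℕ) (m : ℕ) :
    Nat.card ↥(agree x y ∩ Set.Iio m) = Nat.count (fun m => x m = y m) m := by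
  rw [Nat.count_eq_card_filter_range, Nat.card_coe_set_eq, ← Set.ncard_coe_finset]
  congr 1
  ext n
  simp [agree, and_comm]

lemma key {hh : ℕ → ℕ} (hpos : ∀ n, 1 ≤ hh n) {p q δ : ℝ} (hq : 0 ≤ q) (hδ : 0 ≤ δ)
    (hpq : p * (1 + δ) < q)
    (hgrow : ∀ᶠ n in atTop, (hh n : ℝ) ≤ δ * blk hh n)
    {x : ℕ → ℕ} (hx : IsBitSeq x) (y : ℕ → ℕ)
    (h : ∀ᶠ n in atTop, q ≤ nhd (hh n) (enc hh x n) (y n)) :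
    p < lowerDensity (agree x (dec hh y)) := by
  classical
  obtain ⟨N, hN⟩ := eventually_atTop.1 (h.and hgrow)
  set A := fun m => Nat.count (fun m => x m = dec hh y m) m with hA
  have hA1 : ∀ n ≥ N, q * ((blk hh n : ℝ) - blk hh N) ≤ A (blk hh n) := by
    intro n hn
    induction n, hn using Nat.le_induction with
    | base => simp
    | succ n hn ih =>
      have h1 := block_count hpos hx y n
      have h2 := mul_le_mul_of_nonneg_right (hN n hn).1 (Nat.cast_nonneg (α := ℝ) (hh n))
      have h3 : (blk hh (n + 1) : ℝ) = blk hh n + hh n := by rw [blk_succ]; push_cast; ring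
      simp only [hA] at ih ⊢
      rw [h1, h3]
      linarith
  have h1δ : 0 < 1 + δ := by linarith
  have hpq' : p < q / (1 + δ) := by rwa [lt_div_iff₀ h1δ]
  obtain ⟨p', hp1, hp2⟩ := exists_between hpq'
  refine lt_of_lt_of_le hp1 ?_
  unfold lowerDensity
  have hlim : Tendsto (fun m : ℕ => q / (1 + δ) - (q * blk hh N) / (m : ℝ)) atTop
      (nhds (q / (1 + δ) - 0)) :=
    tendsto_const_nhds.sub (tendsto_const_div_atTop_nhds_zero_nat _)
  rw [sub_zero] at hlim
  have hev := hlim.eventually (lt_mem_nhds hp2)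
  apply le_liminf_of_le
  · apply IsBoundedUnder.isCoboundedUnder_ge
    refine isBoundedUnder_of ⟨1, fun m => ?_⟩
    rw [card_agree]
    apply div_le_one_of_le₀ _ (Nat.cast_nonneg _)
    exact_mod_cast Nat.count_le _
  · filter_upwards [hev, eventually_ge_atTop (blk hh N), eventually_gt_atTop 0] with m hm hmN hm0
    rw [card_agree]
    refine hm.le.trans ?_
    have hm0' : (0 : ℝ) < m := by exact_mod_cast hm0
    set n := idx hh m with hn
    have hb1 : blk hh n ≤ m := blk_idx_le hh m
    have hb2 : m < blk hh (n + 1) := lt_blk_idx hpos m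
    have hnN : N ≤ n := by
      by_contra! hlt
      have := blk_mono hh (Nat.succ_le_of_lt hlt)
      simp only [Nat.succ_eq_add_one] at this
      omega
    have h1 : (A (blk hh n) : ℝ) ≤ A m := by
      exact_mod_cast Nat.count_monotone _ hb1
    have h2 := hA1 n hnN
    have h3 := (hN n hnN).2
    have h4 : (m : ℝ) ≤ blk hh n + hh n := by
      rw [blk_succ] at hb2; exact_mod_cast hb2.le
    have h5 : (m : ℝ) / (1 + δ) ≤ blk hh n := by
      rw [div_le_iff₀ h1δ]; linarith
    have h6 := mul_le_mul_of_nonneg_left h5 hq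
    rw [le_div_iff₀ hm0', sub_mul, div_mul_cancel₀ _ hm0'.ne']
    have h7 : q / (1 + δ) * m = q * (m / (1 + δ)) := by ring
    simp only [hA] at h1 h2
    rw [h7]
    linarith

/-- The block transfer for arbitrary block lengths which grow slowly enough. -/
lemma transfer {hh : ℕ → ℕ} (hpos : ∀ n, 1 ≤ hh n) {p q δ : ℝ} (hp : 0 ≤ p) (hq : 0 ≤ q)
    (hq1 : q ≤ 1) (hδ : 0 ≤ δ) (hpq : p * (1 + δ) < q)
    (hgrow : ∀ᶠ n in atTop, (hh n : ℝ) ≤ δ * blk hh n) :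
    dChar p ≤ dHam hh q ∧ bHam hh q ≤ bChar p := by
  constructor
  · apply le_csInf
    · refine ⟨_, {y | ∀ n, y n < 2 ^ hh n}, rfl, fun y hy => hy, fun x _ => ?_⟩
      refine ⟨fun n => Nat.ofBits (fun i : Fin (hh n) => !(x n).testBit i),
        fun n => Nat.ofBits_lt_two_pow _, Eventually.of_forall fun n => ?_⟩
      have hn : (hh n : ℝ) ≠ 0 := by have := hpos n; positivity
      have : (Finset.range (hh n)).filter (fun i => (x n).testBit i ≠
          (Nat.ofBits (fun i : Fin (hh n) => !(x n).testBit i)).testBit i) =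
          Finset.range (hh n) := by
        apply Finset.filter_true_of_mem
        intro i hi
        rw [Nat.testBit_ofBits_lt _ _ (Finset.mem_range.1 hi)]
        simp
      rw [nhd, this, Finset.card_range, div_self hn]
      exact hq1
    · rintro _ ⟨G, rfl, hG, hG'⟩
      refine le_trans (csInf_le' ⟨dec hh '' G, rfl, ?_, ?_⟩) Cardinal.mk_image_le
      · rintro _ ⟨y, -, rfl⟩
        exact dec_bit hh y
      · intro x hx
        obtain ⟨y, hy, h⟩ := hG' (enc hh x) (enc_lt hh x)
        exact ⟨_, ⟨y, hy, rfl⟩, key hpos hq hδ hpq hgrow hx y h⟩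
  · apply le_csInf
    · refine ⟨_, {x | IsBitSeq x}, rfl, fun x hx => hx, fun y hy => ?_⟩
      refine ⟨fun n => 1 - y n, fun n => show 1 - y n < 2 by omega, ?_⟩
      have : agree (fun n => 1 - y n) y = ∅ := by
        ext n
        have := hy n
        simp only [agree, Set.mem_ofPred_eq, Set.mem_empty_iff_false, iff_false]
        omega
      rw [lowerDensity, this]
      simpa using hp
    · rintro _ ⟨F, rfl, hF, hF'⟩
      refine le_trans (csInf_le' ⟨enc hh '' F, rfl, ?_, ?_⟩) Cardinal.mk_image_le
      · rintro _ ⟨x, -, rfl⟩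
        exact enc_lt hh x
      · intro y _
        obtain ⟨x, hx, h⟩ := hF' (dec hh y) (dec_bit hh y)
        refine ⟨_, ⟨x, hx, rfl⟩, ?_⟩
        by_contra hcon
        rw [not_frequently] at hcon
        refine absurd (key hpos hq hδ hpq hgrow (hF x hx) y ?_) (not_lt.2 h)
        filter_upwards [hcon] with n hn using not_lt.1 hn

/-- The block lengths `⌊2^(n/k)⌋` used in the theorem. -/
noncomputable def expLen (k n : ℕ) : ℕ := ⌊(2 : ℝ) ^ ((n : ℝ) / (k : ℝ))⌋₊

lemma one_le_expLen (k n : ℕ) : 1 ≤ expLen k n := by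
  apply Nat.le_floor
  simpa using Real.one_le_rpow (by norm_num : (1 : ℝ) ≤ 2) (by positivity : (0 : ℝ) ≤ n / k)

lemma expLen_grow (c : ℕ) (hc : 0 < c) :
    ∀ᶠ n in atTop, (expLen (4 * c) n : ℝ) ≤ 1 / (c : ℝ) * blk (expLen (4 * c)) n := by
  set k := 4 * c with hk
  have hk0 : 0 < k := by omega
  filter_upwards [eventually_ge_atTop k] with n hn
  obtain ⟨t, rfl⟩ := Nat.exists_eq_add_of_le' hn
  have hkr : (k : ℝ) ≠ 0 := by positivity
  have hlow : ∀ j, expLen k (t + k) ≤ 4 * expLen k (t + j) := by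
    intro j
    set u : ℝ := (2 : ℝ) ^ ((t : ℝ) / (k : ℝ)) with hu
    have hmono : u ≤ (2 : ℝ) ^ (((t + j : ℕ) : ℝ) / (k : ℝ)) := by
      apply Real.rpow_le_rpow_of_exponent_le (by norm_num)
      gcongr
      omega
    have hub : (expLen k (t + k) : ℝ) ≤ 2 * u := by
      refine (Nat.floor_le (by positivity)).trans (le_of_eq ?_)
      push_cast
      rw [add_div, div_self hkr, Real.rpow_add (by norm_num), Real.rpow_one, mul_comm]
    have hfl : u < (expLen k (t + j) : ℝ) + 1 := hmono.trans_lt (Nat.lt_floor_add_one _)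
    have h1 : (1 : ℝ) ≤ expLen k (t + j) := by exact_mod_cast one_le_expLen k (t + j)
    have : (expLen k (t + k) : ℝ) ≤ 4 * expLen k (t + j) := by linarith
    exact_mod_cast this
  have hsum : c * expLen k (t + k) ≤ blk (expLen k) (t + k) := by
    have h1 : ∑ j ∈ Finset.range k, expLen k (t + k) ≤
        ∑ j ∈ Finset.range k, 4 * expLen k (t + j) := Finset.sum_le_sum fun j _ => hlow j
    rw [Finset.sum_const, Finset.card_range, smul_eq_mul, ← Finset.mul_sum] at h1
    have h2 : ∑ j ∈ Finset.range k, expLen k (t + j) ≤ blk (expLen k) (t + k) := by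
      rw [blk, Finset.sum_range_add]; omega
    have h3 : k * expLen k (t + k) = 4 * (c * expLen k (t + k)) := by rw [hk]; ring
    omega
  have hsum' : (c : ℝ) * expLen k (t + k) ≤ blk (expLen k) (t + k) := by exact_mod_cast hsum
  rw [one_div, inv_mul_eq_div, le_div_iff₀ (by positivity)]
  linarith

/-- The intended content: for `c > 0` a positive `k` works. -/
lemma main_pos (q : ℝ) (hq0 : 0 < q) (hq1 : q < 1 / 2) (c : ℕ) (hc0 : 0 < c)
    (hc : 2 / (c : ℝ) < q) :
    ∃ k : ℕ, 0 < k ∧ dChar (q - 2 / (c : ℝ)) ≤ dHam (expLen k) q ∧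
      bHam (expLen k) q ≤ bChar (q - 2 / (c : ℝ)) := by
  refine ⟨4 * c, by omega, transfer (δ := 1 / c) (one_le_expLen _) (by linarith) hq0.le
    (by linarith) (by positivity) ?_ (expLen_grow c hc0)⟩
  have hd : 0 < 1 / (c : ℝ) := by positivity
  have : 2 / (c : ℝ) = 2 * (1 / c) := by ring
  rw [this]
  nlinarith [mul_pos hd hd]

/-- The degenerate case `c = 0` (where `2 / c` is `0`) is witnessed by blocks of length one. -/
lemma main_zero (q : ℝ) (hq0 : 0 < q) (hq1 : q < 1 / 2) :
    dChar q ≤ dHam (expLen 0) q ∧ bHam (expLen 0) q ≤ bChar q := by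
  have hone : expLen 0 = fun _ => 1 := by funext n; simp [expLen]
  have hiff : ∀ a b : ℕ, q ≤ nhd 1 a b ↔ 1 ≤ nhd 1 a b := by
    intro a b
    by_cases h : a.testBit 0 = b.testBit 0
    · have h0 : nhd 1 a b = 0 := by
        rw [nhd, Finset.range_one, Finset.filter_singleton, if_neg (not_not.2 h)]; simp
      rw [h0]; constructor <;> intro h' <;> linarith
    · have h0 : nhd 1 a b = 1 := by
        rw [nhd, Finset.range_one, Finset.filter_singleton, if_pos h]; simp
      rw [h0]; constructor <;> intro h' <;> linarith
  have hd : dHam (fun _ => 1) q = dHam (fun _ => 1) 1 := by simp only [dHam, hiff]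
  have hb : bHam (fun _ => 1) q = bHam (fun _ => 1) 1 := by
    simp only [bHam, ← not_le, hiff]
  rw [hone, hd, hb]
  refine transfer (δ := 1) (fun _ => le_rfl) hq0.le zero_le_one le_rfl zero_le_one
    (by linarith) ?_
  filter_upwards [eventually_ge_atTop 1] with n hn
  have : (1 : ℝ) ≤ n := by exact_mod_cast hn
  simpa [blk] using hn

/-- For `q ∈ (0,1/2)` and `c` with `2/c < q`, there is `k` such that with
`ĥ(n) = ⌊2^(n/k)⌋`: `𝔡(q − 2/c) ≤ 𝔡⟨≠*, ĥ, q⟩` and `𝔟(q − 2/c) ≥ 𝔟⟨≠*, ĥ, q⟩`. -/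
theorem stmt16 (q : ℝ) (hq0 : 0 < q) (hq1 : q < 1 / 2) (c : ℕ)
    (hc : 2 / (c : ℝ) < q) :
    ∃ k : ℕ,
      dChar (q - 2 / (c : ℝ)) ≤ dHam (fun n => ⌊(2 : ℝ) ^ ((n : ℝ) / (k : ℝ))⌋₊) q ∧
        bHam (fun n => ⌊(2 : ℝ) ^ ((n : ℝ) / (k : ℝ))⌋₊) q ≤ bChar (q - 2 / (c : ℝ)) := by
  rcases Nat.eq_zero_or_pos c with rfl | hc0
  · refine ⟨0, ?_⟩
    have h := main_zero q hq0 hq1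
    have hz : q - 2 / ((0 : ℕ) : ℝ) = q := by simp
    rw [hz]
    exact h
  · obtain ⟨k, -, h⟩ := main_pos q hq0 hq1 c hc0 hc
    exact ⟨k, h⟩

end Paper
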